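/- Let n ≥ 3, a > 0, G(x) = a|x|^{2-n}, and b ∈ C¹ on the closed half-ball cl(B(0,r₀)₊). Set h = G + b. Then lim_{r→0} ∫_{∂⁺B_r} B(h, ∇h) = -(n-1)(n-2) ω_{n-1} a b(0), where ∂⁺B_r = {x : |x| = r, x_n > 0}, B(h,∇h)(x) = C_n |x| ((∇h·η)² - (1/2)|∇h|²) + 2(n-1) h (∇h·η) with η = x/|x|, C_n = 4(n-1)/(n-2), and ω_{n-1} is the surface measure of the unit sphere S^{n-1} in ℝⁿ (so |∂⁺B_r| = (1/2)ω_{n-1} r^{n-1}). -/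

import Mathlib

noncomputable section

open Real Filter Topology MeasureTheory

abbrev E (n : ℕ) := EuclideanSpace ℝ (Fin n)

def pd {n : ℕ} (f : E n → ℝ) (i : Fin n) (x : E n) : ℝ :=
  fderiv ℝ f x (EuclideanSpace.single i 1)

/-- `B(u,∇u)(x) = C_n|x|((∇u·η)² - ½|∇u|²) + 2(n-1) u (∇u·η)` with `η = x/|x|`. -/
def Bqty (n : ℕ) (u : E n → ℝ) (x : E n) : ℝ :=
  (4 * ((n : ℝ) - 1) / ((n : ℝ) - 2)) * ‖x‖ *
      ((∑ i, pd u i x * (x i / ‖x‖)) ^ 2 - (1 / 2) * ∑ i, (pd u i x) ^ 2)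
    + 2 * ((n : ℝ) - 1) * u x * (∑ i, pd u i x * (x i / ‖x‖))

open Set Metric Module
open scoped NNReal ENNReal Pointwise

/-- The open upper half-sphere of radius `r` in the direction of the `k`-th coordinate. -/
def halfSphere {n : ℕ} (k : Fin n) (r : ℝ) : Set (E n) := {x | ‖x‖ = r ∧ 0 < x k}

lemma isAddHaarMeasure_hausdorffMeasure_orthogonal_span_singleton {n : ℕ} {v : E n} (hv : v ≠ 0) :
    (μH[(n : ℝ) - 1] : Measure (Submodule.span ℝ {v})ᗮ).IsAddHaarMeasure := by
  obtain ⟨m, rfl⟩ : ∃ m, n = m + 1 := by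
    rcases n with _ | m
    · exact absurd (Subsingleton.elim v 0) hv
    · exact ⟨m, rfl⟩
  have : Fact (finrank ℝ (E (m + 1)) = m + 1) := ⟨by simp⟩
  have hfin := Submodule.finrank_orthogonal_span_singleton (𝕜 := ℝ) (n := m) hv
  have hcast : ((m + 1 : ℕ) : ℝ) - 1 = (finrank ℝ (Submodule.span ℝ {v})ᗮ : ℝ) := by
    rw [hfin]; push_cast; ring
  rw [hcast]
  infer_instance

lemma hausdorffMeasure_closedHalfSphere_lt_top {n : ℕ} (hn : 1 ≤ n) {v : E n} (hv : ‖v‖ = 1) :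
    μH[(n : ℝ) - 1] {x : E n | ‖x‖ = 1 ∧ inner ℝ v x ≤ 0} < ∞ := by
  have hd : (0 : ℝ) ≤ (n : ℝ) - 1 := by
    have : (1 : ℝ) ≤ n := by exact_mod_cast hn
    linarith
  have hv0 : v ≠ 0 := by rintro rfl; simp at hv
  have := isAddHaarMeasure_hausdorffMeasure_orthogonal_span_singleton hv0
  let f : (Submodule.span ℝ {v})ᗮ → E n := fun w => stereoInvFunAux v (w : E n)
  have hf : ContDiff ℝ 1 f :=
    contDiff_stereoInvFunAux.comp (Submodule.span ℝ {v})ᗮ.subtypeL.contDiff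
  obtain ⟨K, hK⟩ := hf.contDiffOn.exists_lipschitzOnWith one_ne_zero
    (convex_closedBall (0 : (Submodule.span ℝ {v})ᗮ) 2) (isCompact_closedBall _ _)
  have hsub : {x : E n | ‖x‖ = 1 ∧ inner ℝ v x ≤ 0} ⊆
      f '' closedBall (0 : (Submodule.span ℝ {v})ᗮ) 2 := by
    rintro x ⟨hx, hvx⟩
    refine ⟨stereoToFun v x, ?_, ?_⟩
    · rw [mem_closedBall_zero_iff, stereoToFun_apply, norm_smul, innerSL_apply_apply]
      have h1 : ‖(2 : ℝ) / (1 - inner ℝ v x)‖ ≤ 2 := by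
        rw [Real.norm_of_nonneg (by apply div_nonneg <;> linarith)]
        rw [div_le_iff₀ (by linarith)]
        linarith
      have h2 : ‖(Submodule.span ℝ {v})ᗮ.orthogonalProjectionOnto x‖ ≤ 1 :=
        ((Submodule.span ℝ {v})ᗮ.norm_orthogonalProjectionOnto_apply_le x).trans hx.le
      calc _ ≤ (2 : ℝ) * 1 := by gcongr
        _ = 2 := by norm_num
    · have hne : x ≠ v := by
        rintro rfl
        rw [real_inner_self_eq_norm_sq, hv] at hvx
        norm_num at hvx
      exact congrArg Subtype.val
        (stereo_left_inv hv (x := ⟨x, mem_sphere_zero_iff_norm.2 hx⟩) hne)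
  refine (measure_mono hsub).trans_lt ((hK.hausdorffMeasure_image_le hd).trans_lt ?_)
  exact ENNReal.mul_lt_top (ENNReal.rpow_lt_top_of_nonneg hd ENNReal.coe_ne_top)
    (isCompact_closedBall _ _).measure_lt_top

lemma hausdorffMeasure_sphere_lt_top {n : ℕ} (hn : 1 ≤ n) :
    μH[(n : ℝ) - 1] (sphere (0 : E n) 1) < ∞ := by
  have hv : ‖(EuclideanSpace.single ⟨0, hn⟩ 1 : E n)‖ = 1 := by simp
  refine (measure_mono ?_).trans_lt (measure_union_lt_top
    (hausdorffMeasure_closedHalfSphere_lt_top hn hv)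
    (hausdorffMeasure_closedHalfSphere_lt_top hn (v := -EuclideanSpace.single ⟨0, hn⟩ 1)
      (by rw [norm_neg, hv])))
  intro x hx
  rw [mem_sphere_zero_iff_norm] at hx
  rcases le_total (inner ℝ (EuclideanSpace.single ⟨0, hn⟩ 1 : E n) x) 0 with h | h
  · exact Or.inl ⟨hx, h⟩
  · exact Or.inr ⟨hx, by rw [inner_neg_left]; linarith⟩

lemma hausdorffMeasure_equator {n : ℕ} (hn : 1 ≤ n) (k : Fin n) :
    μH[(n : ℝ) - 1] {x : E n | ‖x‖ = 1 ∧ x k = 0} = 0 := by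
  have hd : (0 : ℝ) ≤ (n : ℝ) - 1 := by
    have : (1 : ℝ) ≤ n := by exact_mod_cast hn
    linarith
  let v : E n := EuclideanSpace.single k 1
  have hv : v ≠ 0 := by simp [v]
  have := isAddHaarMeasure_hausdorffMeasure_orthogonal_span_singleton hv
  have himg : {x : E n | ‖x‖ = 1 ∧ x k = 0} =
      Subtype.val '' sphere (0 : (Submodule.span ℝ {v})ᗮ) 1 := by
    ext x
    constructor
    · rintro ⟨hx, hk⟩
      refine ⟨⟨x, Submodule.mem_orthogonal_singleton_iff_inner_right.2 ?_⟩, ?_, rfl⟩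
      · simpa [v, EuclideanSpace.inner_single_left] using hk
      · rw [mem_sphere_zero_iff_norm]; exact hx
    · rintro ⟨⟨y, hy⟩, hy1, rfl⟩
      rw [mem_sphere_zero_iff_norm] at hy1
      refine ⟨hy1, ?_⟩
      simpa [v, EuclideanSpace.inner_single_left] using Submodule.mem_orthogonal_singleton_iff_inner_right.1 hy
  rw [himg, isometry_subtype_coe.hausdorffMeasure_image (Or.inl hd)]
  exact Measure.addHaar_sphere_of_ne_zero _ _ one_ne_zero

lemma measurableSet_halfSphere {n : ℕ} (k : Fin n) (r : ℝ) : MeasurableSet (halfSphere k r) := by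
  apply MeasurableSet.inter
  · exact (isClosed_eq continuous_norm continuous_const).measurableSet
  · exact (isOpen_lt continuous_const (by fun_prop : Continuous fun x : E n => x k)).measurableSet

lemma two_mul_hausdorffMeasure_halfSphere_one {n : ℕ} (hn : 1 ≤ n) (k : Fin n) :
    2 * μH[(n : ℝ) - 1] (halfSphere k 1) = μH[(n : ℝ) - 1] (sphere (0 : E n) 1) := by
  have hneg : μH[(n : ℝ) - 1] (-halfSphere k 1) = μH[(n : ℝ) - 1] (halfSphere k 1) := by
    rw [← Set.image_neg_eq_neg]
    exact (IsometryEquiv.neg (E n)).hausdorffMeasure_image _ _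
  have hunion : sphere (0 : E n) 1 =
      (halfSphere k 1 ∪ -halfSphere k 1) ∪ {x : E n | ‖x‖ = 1 ∧ x k = 0} := by
    ext x
    simp only [mem_sphere_zero_iff_norm, halfSphere, mem_union, Set.mem_neg, mem_ofPred_eq,
      norm_neg, PiLp.neg_apply]
    constructor
    · intro hx
      rcases lt_trichotomy (x k) 0 with h | h | h
      · exact Or.inl (Or.inr ⟨hx, by linarith⟩)
      · exact Or.inr ⟨hx, h⟩
      · exact Or.inl (Or.inl ⟨hx, h⟩)
    · tauto
  have hdisj : Disjoint (halfSphere k 1) (-halfSphere k 1) := by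
    rw [Set.disjoint_left]
    rintro x ⟨-, h1⟩ ⟨-, h2⟩
    rw [PiLp.neg_apply] at h2
    linarith
  rw [hunion, measure_congr (union_ae_eq_left_of_ae_eq_empty
      (ae_eq_empty.2 (hausdorffMeasure_equator hn k))),
    measure_union' hdisj (measurableSet_halfSphere k 1), hneg, two_mul]

lemma hausdorffMeasure_halfSphere_lt_top {n : ℕ} (hn : 1 ≤ n) (k : Fin n) :
    μH[(n : ℝ) - 1] (halfSphere k 1) < ∞ :=
  (measure_mono fun _ hx => mem_sphere_zero_iff_norm.2 hx.1).trans_lt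
    (hausdorffMeasure_sphere_lt_top hn)

lemma halfSphere_eq_smul {n : ℕ} (k : Fin n) {r : ℝ} (hr : 0 < r) :
    halfSphere k r = r • halfSphere k 1 := by
  ext x
  rw [Set.mem_smul_set_iff_inv_smul_mem₀ hr.ne']
  simp only [halfSphere, mem_ofPred_eq, norm_smul, norm_inv, Real.norm_of_nonneg hr.le,
    PiLp.smul_apply, smul_eq_mul]
  rw [inv_mul_eq_one₀ hr.ne', mul_pos_iff_of_pos_left (inv_pos.2 hr), eq_comm]

lemma hausdorffMeasure_halfSphere {n : ℕ} (hn : 1 ≤ n) (k : Fin n) {r : ℝ} (hr : 0 < r) :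
    μH[(n : ℝ) - 1] (halfSphere k r) =
      ENNReal.ofReal (r ^ (n - 1)) * μH[(n : ℝ) - 1] (halfSphere k 1) := by
  have hcast : (n : ℝ) - 1 = ((n - 1 : ℕ) : ℝ) := by push_cast [hn]; ring
  rw [halfSphere_eq_smul k hr, hcast, Measure.hausdorffMeasure_smul₀ (by positivity) hr.ne',
    NNReal.rpow_natCast, ENNReal.smul_def, smul_eq_mul]
  congr 1
  rw [ENNReal.ofReal, Real.toNNReal_pow hr.le, Real.nnnorm_of_nonneg hr.le,
    Real.toNNReal_of_nonneg hr.le]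

/-- If `‖x‖ ^ (n - 1) * F x` tends to `L` as `x → 0` in the upper half-space, the integrals of `F`
over the half-spheres of radius `r` tend to `L` times the measure of the unit half-sphere. -/
lemma tendsto_setIntegral_halfSphere {n : ℕ} (hn : 1 ≤ n) (k : Fin n) {F : E n → ℝ} {L : ℝ}
    (hF : Tendsto (fun x => ‖x‖ ^ (n - 1) * F x) (𝓝[{x | 0 < x k}] 0) (𝓝 L))
    (hmeas : ∀ᶠ r in 𝓝[>] (0 : ℝ),
      AEStronglyMeasurable F ((μH[(n : ℝ) - 1]).restrict (halfSphere k r))) :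
    Tendsto (fun r => ∫ x in halfSphere k r, F x ∂(μH[(n : ℝ) - 1])) (𝓝[>] 0)
      (𝓝 (L * (μH[(n : ℝ) - 1] (halfSphere k 1)).toReal)) := by
  set m := (μH[(n : ℝ) - 1] (halfSphere k 1)).toReal with hm
  have hm0 : 0 ≤ m := ENNReal.toReal_nonneg
  rw [Metric.tendsto_nhds]
  intro ε hε
  have hδ : 0 < ε / (m + 1) := by positivity
  obtain ⟨ρ, hρ, hball⟩ := Metric.mem_nhdsWithin_iff.1 (Metric.tendsto_nhds.1 hF _ hδ)
  filter_upwards [hmeas, Ioo_mem_nhdsGT hρ] with r hr ⟨hr0, hrρ⟩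
  have hbound : ∀ x ∈ halfSphere k r, |r ^ (n - 1) * F x - L| < ε / (m + 1) := by
    intro x hx
    have := hball ⟨mem_ball_zero_iff.2 (hx.1.trans_lt hrρ), hx.2⟩
    simpa [hx.1, Real.dist_eq] using this
  have hp : 0 < r ^ (n - 1) := by positivity
  have hfin : μH[(n : ℝ) - 1] (halfSphere k r) < ∞ := by
    rw [hausdorffMeasure_halfSphere hn k hr0]
    exact ENNReal.mul_lt_top ENNReal.ofReal_lt_top (hausdorffMeasure_halfSphere_lt_top hn k)
  have hreal : (μH[(n : ℝ) - 1]).real (halfSphere k r) = r ^ (n - 1) * m := by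
    rw [measureReal_def, hausdorffMeasure_halfSphere hn k hr0, ENNReal.toReal_mul,
      ENNReal.toReal_ofReal hp.le]
  have hdiff : ∀ x ∈ halfSphere k r,
      ‖F x - L / r ^ (n - 1)‖ ≤ ε / (m + 1) / r ^ (n - 1) := by
    intro x hx
    have heq : F x - L / r ^ (n - 1) = (r ^ (n - 1) * F x - L) / r ^ (n - 1) := by
      field_simp
    rw [heq, Real.norm_eq_abs, abs_div, abs_of_pos hp]
    gcongr
    exact (hbound x hx).le
  have hconst : IntegrableOn (fun _ => L / r ^ (n - 1)) (halfSphere k r) (μH[(n : ℝ) - 1]) :=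
    integrableOn_const hfin.ne
  have hint : IntegrableOn F (halfSphere k r) (μH[(n : ℝ) - 1]) := by
    refine IntegrableOn.of_bound hfin hr (ε / (m + 1) / r ^ (n - 1) + ‖L / r ^ (n - 1)‖) ?_
    filter_upwards [ae_restrict_mem (measurableSet_halfSphere k r)] with x hx
    have := norm_sub_norm_le (F x) (L / r ^ (n - 1))
    linarith [hdiff x hx]
  have hLm : ∫ _ in halfSphere k r, L / r ^ (n - 1) ∂(μH[(n : ℝ) - 1]) = L * m := by
    rw [setIntegral_const, hreal, smul_eq_mul]
    field_simp
  rw [dist_eq_norm, ← hLm, ← integral_sub hint hconst]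
  calc _ ≤ ε / (m + 1) / r ^ (n - 1) * (μH[(n : ℝ) - 1]).real (halfSphere k r) :=
        norm_setIntegral_le_of_norm_le_const hfin hdiff
    _ = ε * (m / (m + 1)) := by rw [hreal]; field_simp
    _ < ε * 1 := by
        gcongr
        rw [div_lt_one (by positivity)]
        linarith
    _ = ε := mul_one ε

lemma hasFDerivAt_norm_rpow_of_ne_zero {n : ℕ} {x : E n} (hx : x ≠ 0) (s : ℝ) :
    HasFDerivAt (fun y : E n => ‖y‖ ^ s) ((s * ‖x‖ ^ (s - 2)) • innerSL ℝ x) x := by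
  have hx' : 0 < ‖x‖ := norm_pos_iff.2 hx
  have hsq : ∀ (y : E n) (t : ℝ), (‖y‖ ^ 2) ^ (t / 2) = ‖y‖ ^ t := fun y t => by
    rw [← Real.rpow_natCast, ← Real.rpow_mul (norm_nonneg y)]
    congr 1
    push_cast
    ring
  have h := (hasStrictFDerivAt_norm_sq x).hasFDerivAt.rpow_const (p := s / 2)
    (Or.inl (by positivity))
  simp only [hsq] at h
  rw [show s / 2 - 1 = (s - 2) / 2 by ring, hsq] at h
  refine h.congr_fderiv ?_
  ext v
  simp only [smul_apply, smul_eq_mul, nsmul_eq_mul, Nat.cast_ofNat]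
  ring

lemma sum_apply_single_mul {n : ℕ} (D : E n →L[ℝ] ℝ) (x : E n) :
    ∑ i, D (EuclideanSpace.single i 1) * x i = D x := by
  conv_rhs => rw [← (EuclideanSpace.basisFun (Fin n) ℝ).sum_repr x]
  simp [mul_comm]

/-- The expansion of `B(a|x|^{2-n} + b)` around `B(b)`, multiplied by `|x|^{n-1}`. -/
lemma norm_pow_mul_Bqty_add {n : ℕ} (hn : 3 ≤ n) (a : ℝ) {b : E n → ℝ} {x : E n} (hx : x ≠ 0)
    (hb : DifferentiableAt ℝ b x) :
    ‖x‖ ^ (n - 1) * Bqty n (fun x => a * ‖x‖ ^ ((2 : ℝ) - n) + b x) x =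
      ‖x‖ ^ (n - 1) * Bqty n b x - 2 * a * ((n : ℝ) - 1) * fderiv ℝ b x x
        - 2 * a * ((n : ℝ) - 1) * ((n : ℝ) - 2) * b x := by
  have hr : 0 < ‖x‖ := norm_pos_iff.2 hx
  have hN : (n : ℝ) - 2 ≠ 0 := by
    have : (3 : ℝ) ≤ n := by exact_mod_cast hn
    linarith
  set r := ‖x‖ with hrdef
  set t : ℝ := r ^ (-(n : ℝ)) with ht
  have ht0 : 0 < t := by positivity
  have hpow : r ^ ((2 : ℝ) - n) = t * r ^ 2 := by
    rw [ht, ← Real.rpow_natCast r 2, ← Real.rpow_add hr]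
    congr 1
    push_cast
    ring
  have hR : r ^ (n - 1) = 1 / (r * t) := by
    rw [eq_div_iff (by positivity), ht, ← mul_assoc, ← pow_succ, Nat.sub_add_cancel (by omega),
      ← Real.rpow_natCast, ← Real.rpow_add hr]
    simp
  have hfd : fderiv ℝ (fun x => a * ‖x‖ ^ ((2 : ℝ) - n) + b x) x =
      (a * (2 - n) * t) • innerSL ℝ x + fderiv ℝ b x := by
    refine (HasFDerivAt.fun_add
      ((hasFDerivAt_norm_rpow_of_ne_zero hx ((2 : ℝ) - n)).const_mul a)
      hb.hasFDerivAt).fderiv.trans ?_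
    rw [smul_smul, ht, ← hrdef, show (2 : ℝ) - n - 2 = -n by ring, mul_assoc]
  set D := fderiv ℝ b x with hD
  set c := a * (2 - n) * t with hc
  have hpd : ∀ i, pd (fun x => a * ‖x‖ ^ ((2 : ℝ) - n) + b x) i x =
      c * x i + D (EuclideanSpace.single i 1) := fun i => by
    rw [pd, hfd]
    simp [EuclideanSpace.inner_single_right]
  have hxx : ∑ i, x i ^ 2 = r ^ 2 := (EuclideanSpace.real_norm_sq_eq x).symm
  have hDx := sum_apply_single_mul D x
  have hpdb : ∀ i, pd b i x = D (EuclideanSpace.single i 1) := fun i => rfl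
  have hlin : ∑ i, (c * x i + D (EuclideanSpace.single i 1)) * (x i / r) =
      (c * r ^ 2 + D x) / r := by
    rw [← hxx, ← hDx, Finset.mul_sum, ← Finset.sum_add_distrib, Finset.sum_div]
    exact Finset.sum_congr rfl fun i _ => by ring
  have hlin' : ∑ i, D (EuclideanSpace.single i 1) * (x i / r) = D x / r := by
    rw [← hDx, Finset.sum_div]
    exact Finset.sum_congr rfl fun i _ => by ring
  have hquad : ∑ i, (c * x i + D (EuclideanSpace.single i 1)) ^ 2 =
      c ^ 2 * r ^ 2 + 2 * c * D x + ∑ i, D (EuclideanSpace.single i 1) ^ 2 := by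
    rw [← hxx, ← hDx, Finset.mul_sum, Finset.mul_sum, ← Finset.sum_add_distrib,
      ← Finset.sum_add_distrib]
    exact Finset.sum_congr rfl fun i _ => by ring
  simp only [Bqty, hpd, hpdb, ← hrdef]
  rw [hlin, hlin', hquad, hpow, hR, hc]
  field_simp
  ring

lemma exists_eventually_norm_fderiv_le {n : ℕ} (k : Fin n) {r₀ : ℝ} (hr₀ : 0 < r₀) {b : E n → ℝ}
    (hb : ContDiffOn ℝ 1 b {x : E n | ‖x‖ ≤ r₀ ∧ 0 ≤ x k}) :
    ∃ M, ∀ᶠ x in 𝓝[{x : E n | 0 < x k}] 0, DifferentiableAt ℝ b x ∧ ‖fderiv ℝ b x‖ ≤ M := by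
  set K := {x : E n | ‖x‖ ≤ r₀ ∧ 0 ≤ x k} with hK
  have hcont : Continuous fun x : E n => x k := by fun_prop
  have hclosed : IsClosed {x : E n | 0 ≤ x k} := isClosed_le continuous_const hcont
  have hKeq : K = closedBall 0 r₀ ∩ {x : E n | 0 ≤ x k} := by
    ext x; simp [hK]
  have hKcomp : IsCompact K := hKeq ▸ (isCompact_closedBall _ _).inter_right hclosed
  have hKconv : Convex ℝ K := by
    rw [hKeq]
    exact (convex_closedBall _ _).inter
      (convex_halfSpace_ge (f := fun x : E n => x k) ⟨fun _ _ => rfl, fun _ _ => rfl⟩ 0)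
  have hnhds : ∀ x : E n, ‖x‖ < r₀ → 0 < x k → K ∈ 𝓝 x := fun x h1 h2 => by
    filter_upwards [(isOpen_lt continuous_norm continuous_const).mem_nhds h1,
      (isOpen_lt continuous_const hcont).mem_nhds h2] with y hy1 hy2
    exact ⟨le_of_lt hy1, le_of_lt hy2⟩
  have hint : (interior K).Nonempty := by
    refine ⟨EuclideanSpace.single k (r₀ / 2), mem_interior_iff_mem_nhds.2 (hnhds _ ?_ ?_)⟩
    · simp only [PiLp.norm_single, Real.norm_eq_abs]
      rw [abs_of_pos (by positivity)]
      linarith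
    · simpa using hr₀
  obtain ⟨M, hM⟩ := hKcomp.exists_bound_of_continuousOn
    (hb.continuousOn_fderivWithin (uniqueDiffOn_convex hKconv hint) le_rfl)
  refine ⟨M, ?_⟩
  filter_upwards [self_mem_nhdsWithin, nhdsWithin_le_nhds (ball_mem_nhds (0 : E n) hr₀)]
    with x hxk hx
  rw [mem_ball_zero_iff] at hx
  have hKx := hnhds x hx hxk
  have hxK : x ∈ K := mem_of_mem_nhds hKx
  refine ⟨(hb.contDiffAt hKx).differentiableAt one_ne_zero, ?_⟩
  rw [← fderivWithin_of_mem_nhds hKx]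
  exact hM x hxK

lemma isBigO_one_Bqty {n : ℕ} {l : Filter (E n)} {b : E n → ℝ} {M B₀ : ℝ}
    (hl : l ≤ 𝓝 0) (hM : ∀ᶠ x in l, ‖fderiv ℝ b x‖ ≤ M) (hb : Tendsto b l (𝓝 B₀)) :
    Bqty n b =O[l] (fun _ => (1 : ℝ)) := by
  have hpd : ∀ i, (fun x => pd b i x) =O[l] (fun _ => (1 : ℝ)) := fun i => by
    refine Asymptotics.IsBigO.of_bound M ?_
    filter_upwards [hM] with x hx
    calc ‖pd b i x‖ ≤ ‖fderiv ℝ b x‖ * ‖(EuclideanSpace.single i 1 : E n)‖ :=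
          (fderiv ℝ b x).le_opNorm _
      _ ≤ M * ‖(1 : ℝ)‖ := by simpa using hx
  have hη : ∀ i, (fun x : E n => x i / ‖x‖) =O[l] (fun _ => (1 : ℝ)) := fun i => by
    refine Asymptotics.IsBigO.of_bound 1 (Eventually.of_forall fun x => ?_)
    rw [norm_div, norm_norm, norm_one, mul_one]
    exact div_le_one_of_le₀ (PiLp.norm_apply_le x i) (norm_nonneg x)
  have hlin : (fun x => ∑ i, pd b i x * (x i / ‖x‖)) =O[l] (fun _ => (1 : ℝ)) :=
    Asymptotics.IsBigO.fun_sum fun i _ => by simpa using (hpd i).mul (hη i)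
  have hquad : (fun x => ∑ i, (pd b i x) ^ 2) =O[l] (fun _ => (1 : ℝ)) :=
    Asymptotics.IsBigO.fun_sum fun i _ => by simpa using (hpd i).pow 2
  have hnorm : (fun x : E n => ‖x‖) =O[l] (fun _ => (1 : ℝ)) :=
    (continuous_norm.continuousAt.tendsto.mono_left hl).isBigO_one ℝ
  have hlin2 : (fun x => (∑ i, pd b i x * (x i / ‖x‖)) ^ 2) =O[l] (fun _ => (1 : ℝ)) := by
    simpa using hlin.pow 2
  have h1 := (hnorm.const_mul_left (4 * ((n : ℝ) - 1) / ((n : ℝ) - 2))).mul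
    (hlin2.sub (hquad.const_mul_left (1 / 2)))
  have h2 := ((hb.isBigO_one ℝ).const_mul_left (2 * ((n : ℝ) - 1))).mul hlin
  simpa [Bqty, Function.comp_def] using h1.add h2

lemma tendsto_norm_pow_mul_Bqty {n : ℕ} (hn : 3 ≤ n) (k : Fin n) (a : ℝ) {r₀ : ℝ} (hr₀ : 0 < r₀)
    {b : E n → ℝ} (hb : ContDiffOn ℝ 1 b {x : E n | ‖x‖ ≤ r₀ ∧ 0 ≤ x k}) :
    Tendsto (fun x => ‖x‖ ^ (n - 1) * Bqty n (fun x => a * ‖x‖ ^ ((2 : ℝ) - n) + b x) x)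
      (𝓝[{x : E n | 0 < x k}] 0) (𝓝 (-(2 * a * ((n : ℝ) - 1) * ((n : ℝ) - 2) * b 0))) := by
  set l : Filter (E n) := 𝓝[{x : E n | 0 < x k}] 0
  have hl : l ≤ 𝓝 0 := nhdsWithin_le_nhds
  obtain ⟨M, hM⟩ := exists_eventually_norm_fderiv_le k hr₀ hb
  have hb0 : Tendsto b l (𝓝 (b 0)) := by
    refine (hb.continuousOn 0 (by simp [hr₀.le])).tendsto.mono_left
      (nhdsWithin_le_of_mem ?_)
    filter_upwards [self_mem_nhdsWithin, nhdsWithin_le_nhds (ball_mem_nhds (0 : E n) hr₀)]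
      with x hxk hx
    exact ⟨(mem_ball_zero_iff.1 hx).le, le_of_lt hxk⟩
  have hnorm : Tendsto (fun x : E n => ‖x‖) l (𝓝 0) := tendsto_norm_zero.mono_left hl
  have hB : Tendsto (fun x => ‖x‖ ^ (n - 1) * Bqty n b x) l (𝓝 0) := by
    refine Tendsto.zero_mul_isBoundedUnder_le ?_
      ((isBigO_one_Bqty hl (hM.mono fun x hx => hx.2) hb0).isBoundedUnder_le)
    simpa [show n - 1 ≠ 0 by omega] using hnorm.pow (n - 1)
  have hD : Tendsto (fun x => fderiv ℝ b x x) l (𝓝 0) := by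
    refine squeeze_zero_norm' (a := fun x => M * ‖x‖) ?_ (by simpa using hnorm.const_mul M)
    filter_upwards [hM] with x hx
    exact (fderiv ℝ b x).le_of_opNorm_le hx.2 x
  have hlim := (hB.sub (hD.const_mul (2 * a * ((n : ℝ) - 1)))).sub
    (hb0.const_mul (2 * a * ((n : ℝ) - 1) * ((n : ℝ) - 2)))
  rw [mul_zero, sub_zero, zero_sub] at hlim
  refine hlim.congr' ?_
  filter_upwards [hM, self_mem_nhdsWithin] with x hx hxk
  have hx0 : x ≠ 0 := by rintro rfl; simp at hxk
  exact (norm_pow_mul_Bqty_add hn a hx0 hx.1).symm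

lemma aestronglyMeasurable_Bqty {n : ℕ} {μ : Measure (E n)} {u : E n → ℝ}
    (hu : AEStronglyMeasurable u μ) : AEStronglyMeasurable (Bqty n u) μ := by
  have hpd : ∀ i, Measurable (pd u i) := fun i => measurable_fderiv_apply_const ℝ u _
  have hlin : Measurable fun x => ∑ i, pd u i x * (x i / ‖x‖) := by fun_prop
  have hquad : Measurable fun x => ∑ i, (pd u i x) ^ 2 := by fun_prop
  have hmain : Measurable fun x : E n => (4 * ((n : ℝ) - 1) / ((n : ℝ) - 2)) * ‖x‖ *
      ((∑ i, pd u i x * (x i / ‖x‖)) ^ 2 - (1 / 2) * ∑ i, (pd u i x) ^ 2) := by fun_prop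
  exact hmain.aestronglyMeasurable.add ((hu.const_mul _).mul hlin.aestronglyMeasurable)

/-- for `h = a|x|^{2-n} + b` with `b` of class `C¹` on the closed half-ball,
`lim_{r→0} ∫_{∂⁺B_r} B(h,∇h) = -(n-1)(n-2) ω_{n-1} a b(0)`, where `∂⁺B_r` is the upper
half-sphere of radius `r` (integration with respect to the `(n-1)`-dimensional Hausdorff
measure) and `ω_{n-1}` is the surface measure of the unit sphere of `ℝⁿ`. -/
theorem stmt8 (n : ℕ) (hn : 3 ≤ n) (a : ℝ) (ha : 0 < a) (r₀ : ℝ) (hr₀ : 0 < r₀)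
    (b : E n → ℝ)
    (hb : ContDiffOn ℝ 1 b {x : E n | ‖x‖ ≤ r₀ ∧ 0 ≤ x ⟨n - 1, by omega⟩})
    (h : E n → ℝ) (hh : h = fun x => a * ‖x‖ ^ ((2 : ℝ) - n) + b x) :
    Tendsto
      (fun r : ℝ =>
        ∫ x in {x : E n | ‖x‖ = r ∧ 0 < x ⟨n - 1, by omega⟩},
          Bqty n h x ∂(μH[((n : ℝ) - 1)]))
      (𝓝[>] 0)
      (𝓝 (-(((n : ℝ) - 1) * ((n : ℝ) - 2) *
          (μH[((n : ℝ) - 1)] (Metric.sphere (0 : E n) 1)).toReal * a * b 0))) := by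
  have hn1 : 1 ≤ n := by omega
  have hmeas : ∀ᶠ r in 𝓝[>] (0 : ℝ), AEStronglyMeasurable (Bqty n h)
      ((μH[(n : ℝ) - 1]).restrict (halfSphere ⟨n - 1, by omega⟩ r)) := by
    filter_upwards [Ioo_mem_nhdsGT hr₀] with r hr
    have hbr : AEStronglyMeasurable b
        ((μH[(n : ℝ) - 1]).restrict (halfSphere ⟨n - 1, by omega⟩ r)) :=
      (hb.continuousOn.mono fun x hx => ⟨hx.1.trans_le hr.2.le, hx.2.le⟩).aestronglyMeasurable
        (measurableSet_halfSphere _ r)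
    have hG : Measurable fun x : E n => a * ‖x‖ ^ ((2 : ℝ) - n) := by fun_prop
    rw [hh]
    exact aestronglyMeasurable_Bqty (hG.aestronglyMeasurable.add hbr)
  have hlim := tendsto_norm_pow_mul_Bqty hn ⟨n - 1, by omega⟩ a hr₀ hb
  rw [← hh] at hlim
  have hmain := tendsto_setIntegral_halfSphere hn1 ⟨n - 1, by omega⟩ hlim hmeas
  have hvalue : -(2 * a * ((n : ℝ) - 1) * ((n : ℝ) - 2) * b 0) *
      (μH[(n : ℝ) - 1] (halfSphere (n := n) ⟨n - 1, by omega⟩ 1)).toReal =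
      -(((n : ℝ) - 1) * ((n : ℝ) - 2) *
        (μH[(n : ℝ) - 1] (sphere (0 : E n) 1)).toReal * a * b 0) := by
    rw [← two_mul_hausdorffMeasure_halfSphere_one hn1 ⟨n - 1, by omega⟩, ENNReal.toReal_mul,
      ENNReal.toReal_ofNat]
    ring
  rw [hvalue] at hmain
  exact hmain
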